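/- Let 0<p,q<∞, let ω∈D, and let K∈ℕ with K≥2 be such that ŵ(r)≥Cŵ(1−(1−r)/K) for all 0≤r<1 with some C>1. For f analytic on 𝔻 set f_{j,l}=sup_{z∈Q_{j,l}}|f(z)| and λ(f)_{j,l}=K^{−j/p} ŵ(r_j)^{1/q} f_{j,l}. Then ‖f‖_{A^{p,q}_ω} ≍ ‖λ(f)‖_{ℓ^{p,q}} for all f analytic on 𝔻, with comparability constants independent of f. -/

import Mathlib

open Complex MeasureTheory
open scoped ENNReal Real

noncomputable section

/-- `ŵ(r) = ∫_r^1 ω(s) ds`. -/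
def wh (ω : ℝ → ℝ) (r : ℝ) : ℝ := ∫ s in r..(1:ℝ), ω s

/-- A radial weight, viewed as a function of the modulus: nonnegative and
integrable on `(0,1)`. -/
def RadialWeight (ω : ℝ → ℝ) : Prop :=
  (∀ r, 0 ≤ ω r) ∧ IntervalIntegrable ω MeasureTheory.volume 0 1

/-- The class `D̂`. -/
def Dhat (ω : ℝ → ℝ) : Prop :=
  ∃ C : ℝ, 1 ≤ C ∧ ∀ r : ℝ, 0 ≤ r → r < 1 → wh ω r ≤ C * wh ω ((1 + r) / 2)

/-- The class `Ď`. -/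
def Dcheck (ω : ℝ → ℝ) : Prop :=
  ∃ K : ℝ, 1 < K ∧ ∃ C : ℝ, 1 < C ∧ ∀ r : ℝ, 0 ≤ r → r < 1 →
    C * wh ω (1 - (1 - r) / K) ≤ wh ω r

/-- The class of doubling weights `D = D̂ ∩ Ď`. -/
def DClass (ω : ℝ → ℝ) : Prop := Dhat ω ∧ Dcheck ω

/-- The radii `r_j = 1 − K^{−j}`. -/
def rK (K : ℕ) (j : ℕ) : ℝ := 1 - ((K : ℝ) ^ j)⁻¹

/-- The dyadic polar rectangle `Q_{j,l}`. -/
def Qset (K j l : ℕ) : Set ℂ :=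
  {w : ℂ | rK K j ≤ ‖w‖ ∧ ‖w‖ < rK K (j + 1) ∧
    ∃ θ : ℝ, 2 * Real.pi * l / (K : ℝ) ^ (j + 3) ≤ θ ∧
      θ < 2 * Real.pi * (l + 1) / (K : ℝ) ^ (j + 3) ∧
      w = (‖w‖ : ℂ) * Complex.exp ((θ : ℂ) * Complex.I)}

/-- The point `r e^{it}` of the circle of radius `r`. -/
def circ (r t : ℝ) : ℂ := (r : ℂ) * Complex.exp ((t : ℂ) * Complex.I)

/-- The integral mean `M_p(r,f)` for `0 < p < ∞`. -/
def MpR (p : ℝ) (f : ℂ → ℂ) (r : ℝ) : ℝ :=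
  ((2 * Real.pi)⁻¹ *
      ∫ t in (0:ℝ)..(2 * Real.pi), ‖f (circ r t)‖ ^ p) ^ p⁻¹

/-- `‖f‖_{A^{p,q}_ω} = (∫_0^1 M_p(r,f)^q ω(r) dr)^{1/q}`, computed in `ℝ≥0∞`. -/
def ApqE (p q : ℝ) (ω : ℝ → ℝ) (f : ℂ → ℂ) : ℝ≥0∞ :=
  (∫⁻ r in Set.Ioo (0:ℝ) 1, ENNReal.ofReal (MpR p f r) ^ q * ENNReal.ofReal (ω r)) ^ q⁻¹

/-- The `ℓ^{p,q}`-norm of a double sequence of extended nonnegative reals. -/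
def lpqR (p q : ℝ) (Λ : ℕ → ℕ → ℝ≥0∞) : ℝ≥0∞ :=
  (∑' j : ℕ, ((∑' l : ℕ, Λ j l ^ p) ^ p⁻¹) ^ q) ^ q⁻¹

/-- The sequence `λ(f)_{j,l} = K^{−j/p} ŵ(r_j)^{1/q} sup_{Q_{j,l}} |f|`
(extended by zero outside the range `l < K^{j+3}`). -/
def lamSeq (K : ℕ) (p q : ℝ) (ω : ℝ → ℝ) (f : ℂ → ℂ) : ℕ → ℕ → ℝ≥0∞ :=
  fun j l =>
    if l < K ^ (j + 3) then
      ENNReal.ofReal ((K : ℝ) ^ (-(j : ℝ) / p) * wh ω (rK K j) ^ (1 / q)) *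
        ⨆ w ∈ Qset K j l, ENNReal.ofReal ‖f w‖
    else 0

/-- Jensen's formula gives the sub-mean value property of `log ‖h‖`. -/
lemma log_norm_le_circleAverage {R : ℝ} (hR : 0 < R) {c : ℂ} {h : ℂ → ℂ}
    (hh : AnalyticOnNhd ℂ h (Metric.closedBall c R)) (hc : h c ≠ 0) :
    Real.log ‖h c‖ ≤ Real.circleAverage (fun z => Real.log ‖h z‖) c R := by
  have hh' : AnalyticOnNhd ℂ h (Metric.closedBall c |R|) := by rwa [abs_of_pos hR]
  rw [hh'.circleAverage_log_norm hR.ne' hc]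
  refine le_add_of_nonneg_left (finsum_nonneg fun u => ?_)
  by_cases hu : u ∈ Metric.closedBall c |R|
  · refine mul_nonneg (by exact_mod_cast MeromorphicOn.AnalyticOnNhd.divisor_nonneg hh' u) ?_
    rcases eq_or_ne u c with rfl | huc
    · simp
    · have h1 : 0 < ‖c - u‖ := norm_pos_iff.2 (sub_ne_zero.2 huc.symm)
      apply Real.log_nonneg
      rw [← div_eq_mul_inv, one_le_div h1]
      rwa [Metric.mem_closedBall, dist_comm, dist_eq_norm, abs_of_pos hR] at hu
  · simp [hu]

/-- Sub-mean value property of `‖h‖ ^ p` for analytic `h`. -/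
lemma norm_rpow_le_circleAverage {p R : ℝ} (hp : 0 < p) (hR : 0 < R) {c : ℂ} {h : ℂ → ℂ}
    (hh : AnalyticOnNhd ℂ h (Metric.closedBall c R)) :
    ‖h c‖ ^ p ≤ Real.circleAverage (fun z => ‖h z‖ ^ p) c R := by
  by_cases hc : h c = 0
  · rw [hc, norm_zero, Real.zero_rpow hp.ne']
    exact Real.circleAverage_nonneg_of_nonneg fun z _ => by positivity
  have hsub : Metric.sphere c |R| ⊆ Metric.closedBall c R := by
    rw [abs_of_pos hR]; exact Metric.sphere_subset_closedBall
  have hne : (fun z => Real.exp (p * Real.log ‖h z‖))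
      =ᶠ[Filter.codiscreteWithin (Metric.sphere c |R|)] fun z => ‖h z‖ ^ p := by
    have h0 := (hh.eqOn_zero_or_eventually_ne_zero_of_preconnected
      (convex_closedBall c R).isPreconnected).resolve_left
        (fun h0 => hc (h0 (Metric.mem_closedBall_self hR.le)))
    filter_upwards [Filter.codiscreteWithin_mono hsub h0] with z hz
    rw [Real.rpow_def_of_pos (norm_pos_iff.2 hz), mul_comm]
  have hintegrable : CircleIntegrable (fun z => ‖h z‖ ^ p) c R := by
    apply ContinuousOn.circleIntegrable hR.le
    rw [abs_of_pos hR] at hsub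
    exact ((hh.continuousOn.mono hsub).norm).rpow_const fun _ _ => Or.inr hp.le
  have hlog : CircleIntegrable (fun z => Real.log ‖h z‖) c R :=
    MeromorphicOn.circleIntegrable_log_norm (hh.mono hsub).meromorphicOn
  have hintegrable' : CircleIntegrable (fun z => Real.exp (p * Real.log ‖h z‖)) c R :=
    hintegrable.congr_codiscreteWithin hne.symm
  set L := Real.circleAverage (fun z => Real.log ‖h z‖) c R with hL
  have hcL := log_norm_le_circleAverage hR hh hc
  rw [← Real.circleAverage_congr_codiscreteWithin hne hR.ne']
  have hconst : ∀ a : ℝ, CircleIntegrable (fun _ => a) c R := fun a => circleIntegrable_const a c R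
  have h1 : CircleIntegrable (fun z => (Real.exp (p * L) * p) • Real.log ‖h z‖) c R :=
    hlog.const_smul
  calc ‖h c‖ ^ p = Real.exp (p * Real.log ‖h c‖) := by
        rw [Real.rpow_def_of_pos (norm_pos_iff.2 hc), mul_comm]
    _ ≤ Real.exp (p * L) := by gcongr
    _ = Real.circleAverage (fun z => (Real.exp (p * L) * p) • Real.log ‖h z‖
          + Real.exp (p * L) * (1 - p * L)) c R := by
        rw [Real.circleAverage_fun_add h1 (hconst _), Real.circleAverage_fun_smul,
          Real.circleAverage_const, ← hL, smul_eq_mul]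
        ring
    _ ≤ _ := by
        refine Real.circleAverage_mono (CircleIntegrable.add h1 (hconst _)) hintegrable' fun z _ => ?_
        have h2 := Real.add_one_le_exp (p * Real.log ‖h z‖ - p * L)
        have h3 : Real.exp (p * Real.log ‖h z‖)
            = Real.exp (p * L) * Real.exp (p * Real.log ‖h z‖ - p * L) := by
          rw [← Real.exp_add]; ring_nf
        rw [h3, smul_eq_mul]
        nlinarith [Real.exp_pos (p * L)]

/-- Circle averages over centred circles as averages over rotations of a point. -/
lemma circleAverage_norm_eq (F : ℂ → ℝ) (z : ℂ) :
    Real.circleAverage F 0 ‖z‖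
      = (2 * Real.pi)⁻¹ * ∫ t in (0:ℝ)..(2 * Real.pi), F (z * Complex.exp (t * Complex.I)) := by
  rw [Real.circleAverage_eq_integral_add z.arg, smul_eq_mul]
  congr 2
  ext t
  congr 1
  nth_rewrite 3 [← Complex.norm_mul_exp_arg_mul_I z]
  rw [circleMap, zero_add, mul_assoc, ← Complex.exp_add]
  push_cast
  ring_nf

/-- The mean of `‖f‖ ^ p` over centred circles is a subharmonic function of the centre. -/
lemma circleAverage_norm_le_circleAverage {p : ℝ} (hp : 0 < p) {f : ℂ → ℂ}
    (hf : DifferentiableOn ℂ f (Metric.ball 0 1)) {z : ℂ} {ε : ℝ} (hε : 0 < ε)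
    (hz : ‖z‖ + ε < 1) :
    Real.circleAverage (fun w => ‖f w‖ ^ p) 0 ‖z‖ ≤ Real.circleAverage
      (fun v => Real.circleAverage (fun w => ‖f w‖ ^ p) 0 ‖v‖) z ε := by
  have hπ : 0 < 2 * Real.pi := Real.two_pi_pos
  have hcont : ContinuousOn (fun w => ‖f w‖ ^ p) (Metric.ball 0 1) :=
    hf.continuousOn.norm.rpow_const fun _ _ => Or.inr hp.le
  have hmem : ∀ θ t : ℝ, circleMap z ε θ * Complex.exp (t * Complex.I) ∈ Metric.ball (0:ℂ) 1 := by
    intro θ t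
    rw [mem_ball_zero_iff, norm_mul, Complex.norm_exp_ofReal_mul_I, mul_one]
    calc ‖circleMap z ε θ‖ ≤ ‖z‖ + ‖(ε:ℂ) * Complex.exp (θ * Complex.I)‖ := norm_add_le _ _
      _ < 1 := by simpa [Complex.norm_exp_ofReal_mul_I, abs_of_pos hε] using hz
  have hmem' : ∀ t : ℝ, z * Complex.exp (t * Complex.I) ∈ Metric.ball (0:ℂ) 1 := by
    intro t
    rw [mem_ball_zero_iff, norm_mul, Complex.norm_exp_ofReal_mul_I, mul_one]
    linarith
  have hjoint : Continuous (Function.uncurry fun t θ : ℝ =>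
      ‖f (circleMap z ε θ * Complex.exp (t * Complex.I))‖ ^ p) := by
    refine hcont.comp_continuous
      (f := fun x : ℝ × ℝ => circleMap z ε x.2 * Complex.exp (x.1 * Complex.I)) ?_
      fun x => hmem x.2 x.1
    unfold circleMap
    fun_prop
  have hsub : ∀ t : ℝ, ‖f (z * Complex.exp (t * Complex.I))‖ ^ p ≤ (2 * Real.pi)⁻¹ *
      ∫ θ in (0:ℝ)..(2 * Real.pi), ‖f (circleMap z ε θ * Complex.exp (t * Complex.I))‖ ^ p := by
    intro t
    have hana : AnalyticOnNhd ℂ (fun w => f (w * Complex.exp (t * Complex.I)))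
        (Metric.closedBall z ε) := by
      intro w hw
      have hw1 : w * Complex.exp (t * Complex.I) ∈ Metric.ball (0:ℂ) 1 := by
        rw [mem_ball_zero_iff, norm_mul, Complex.norm_exp_ofReal_mul_I, mul_one]
        have := norm_le_norm_add_norm_sub' w z
        rw [Metric.mem_closedBall, dist_eq_norm] at hw
        linarith
      have h1 : AnalyticAt ℂ f (w * Complex.exp (t * Complex.I)) :=
        (hf.analyticOnNhd Metric.isOpen_ball) _ hw1
      exact h1.fun_comp (f := fun w : ℂ => w * Complex.exp (t * Complex.I)) (by fun_prop)
    exact norm_rpow_le_circleAverage hp hε hana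
  rw [circleAverage_norm_eq]
  conv_rhs => rw [Real.circleAverage_def]
  simp_rw [circleAverage_norm_eq]
  rw [smul_eq_mul, intervalIntegral.integral_const_mul]
  gcongr
  calc ∫ t in (0:ℝ)..(2 * Real.pi), ‖f (z * Complex.exp (t * Complex.I))‖ ^ p
      ≤ ∫ t in (0:ℝ)..(2 * Real.pi), (2 * Real.pi)⁻¹ * ∫ θ in (0:ℝ)..(2 * Real.pi),
          ‖f (circleMap z ε θ * Complex.exp (t * Complex.I))‖ ^ p := by
        refine intervalIntegral.integral_mono hπ.le ?_ ?_ hsub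
        · refine (hcont.comp_continuous ?_ hmem').intervalIntegrable _ _
          fun_prop
        · refine (Continuous.const_mul ?_ _).intervalIntegrable _ _
          exact intervalIntegral.continuous_parametric_intervalIntegral_of_continuous' hjoint _ _
    _ = _ := by
        rw [intervalIntegral.integral_const_mul, intervalIntegral_intervalIntegral_swap]
        exact (hjoint.continuousOn.integrableOn_compact
          (isCompact_uIcc.prod isCompact_uIcc)).mono_set
            (Set.prod_mono Set.uIoc_subset_uIcc Set.uIoc_subset_uIcc)

/-- Means of `‖f‖ ^ p` over centred circles increase with the radius (Hardy). -/
lemma circleAverage_norm_rpow_mono {p : ℝ} (hp : 0 < p) {f : ℂ → ℂ}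
    (hf : DifferentiableOn ℂ f (Metric.ball 0 1)) {r ρ : ℝ} (hr : 0 ≤ r) (hrρ : r ≤ ρ)
    (hρ : ρ < 1) :
    Real.circleAverage (fun w => ‖f w‖ ^ p) 0 r ≤ Real.circleAverage (fun w => ‖f w‖ ^ p) 0 ρ := by
  set J : ℝ → ℝ := Real.circleAverage (fun w => ‖f w‖ ^ p) 0 with hJ
  have hJcont : ContinuousOn J (Set.Icc 0 ρ) := by
    refine Real.ContinuousOn.circleAverage ?_ fun r hr => hr.1
    refine (hf.continuousOn.norm.rpow_const fun _ _ => Or.inr hp.le).mono ?_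
    intro z hz
    rw [mem_ball_zero_iff]
    simpa using hz.2.trans_lt hρ
  obtain ⟨s, hs, hmax⟩ := isCompact_Icc.exists_isMaxOn ⟨r, hr, hrρ⟩ hJcont
  by_contra! hlt
  have hsr : J r ≤ J s := hmax ⟨hr, hrρ⟩
  have hsρ : s < ρ := lt_of_le_of_ne hs.2 fun h => by rw [h] at hsr; linarith
  have hε : 0 < ρ - s := sub_pos.2 hsρ
  have hns : ‖(s:ℂ)‖ = s := by simp [abs_of_nonneg hs.1]
  have h1 := circleAverage_norm_le_circleAverage hp hf (z := s) hε (by rw [hns]; linarith)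
  rw [← hJ, hns, Real.circleAverage_def, smul_eq_mul] at h1
  have hmem : ∀ θ : ℝ, ‖circleMap (s:ℂ) (ρ - s) θ‖ ∈ Set.Icc 0 ρ := by
    refine fun θ => ⟨norm_nonneg _, (norm_add_le _ _).trans ?_⟩
    rw [norm_mul, Complex.norm_exp_ofReal_mul_I, hns, mul_one, Complex.norm_real,
      Real.norm_of_nonneg hε.le]
    linarith
  have h2 : ∫ θ in (0:ℝ)..(2 * Real.pi), J ‖circleMap (s:ℂ) (ρ - s) θ‖
      < ∫ _ in (0:ℝ)..(2 * Real.pi), J s := by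
    refine intervalIntegral.integral_lt_integral_of_continuousOn_of_le_of_exists_lt
      Real.two_pi_pos ?_ continuousOn_const (fun θ _ => hmax (hmem θ)) ⟨0, by simp [Real.pi_pos.le], ?_⟩
    · exact (hJcont.comp_continuous (by fun_prop) hmem).continuousOn
    · have : ‖circleMap (s:ℂ) (ρ - s) 0‖ = ρ := by
        simp [circleMap, abs_of_nonneg (hs.1.trans hs.2)]
      rw [this]
      linarith
  rw [intervalIntegral.integral_const, smul_eq_mul, sub_zero] at h2
  have h3 : (2 * Real.pi)⁻¹ * ∫ θ in (0:ℝ)..(2 * Real.pi), J ‖circleMap (s:ℂ) (ρ - s) θ‖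
      < (2 * Real.pi)⁻¹ * (2 * Real.pi * J s) := by gcongr
  rw [inv_mul_cancel_left₀ Real.two_pi_pos.ne'] at h3
  linarith

/-- `M_p(r, f) = (mean of ‖f‖ ^ p) ^ (1 / p)`. -/
lemma MpR_eq (p : ℝ) (f : ℂ → ℂ) (r : ℝ) :
    MpR p f r = (Real.circleAverage (fun w => ‖f w‖ ^ p) 0 r) ^ p⁻¹ := by
  simp [MpR, Real.circleAverage_def, circ, circleMap]

lemma circleAverage_norm_rpow_nonneg (p : ℝ) (f : ℂ → ℂ) (r : ℝ) :
    0 ≤ Real.circleAverage (fun w => ‖f w‖ ^ p) 0 r :=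
  Real.circleAverage_nonneg_of_nonneg fun _ _ => by positivity

lemma MpR_mono {p : ℝ} (hp : 0 < p) {f : ℂ → ℂ}
    (hf : DifferentiableOn ℂ f (Metric.ball 0 1)) {r ρ : ℝ} (hr : 0 ≤ r) (hrρ : r ≤ ρ)
    (hρ : ρ < 1) : MpR p f r ≤ MpR p f ρ := by
  rw [MpR_eq, MpR_eq]
  exact Real.rpow_le_rpow (circleAverage_norm_rpow_nonneg p f r)
    (circleAverage_norm_rpow_mono hp hf hr hrρ hρ) (by positivity)

lemma lintegral_Ioc_ofReal {φ : ℝ → ℝ} {a b : ℝ} (hab : a ≤ b)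
    (hφ : IntervalIntegrable φ volume a b) (h0 : ∀ x ∈ Set.Ioc a b, 0 ≤ φ x) :
    ∫⁻ x in Set.Ioc a b, ENNReal.ofReal (φ x) = ENNReal.ofReal (∫ x in a..b, φ x) := by
  rw [intervalIntegral.integral_of_le hab,
    ofReal_integral_eq_lintegral_ofReal hφ.1 (ae_restrict_of_forall_mem measurableSet_Ioc h0)]

/-- Area form of the sub-mean value property of `‖h‖ ^ p`. -/
lemma norm_rpow_mul_area_le {p δ : ℝ} (hp : 0 < p) (hδ : 0 < δ) {c : ℂ} {h : ℂ → ℂ}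
    (hh : AnalyticOnNhd ℂ h (Metric.closedBall c δ)) :
    ENNReal.ofReal (‖h c‖ ^ p) * ENNReal.ofReal (Real.pi * δ ^ 2)
      ≤ ∫⁻ z in Metric.ball c δ, ENNReal.ofReal (‖h z‖ ^ p) := by
  have hcontb : ContinuousOn (fun z => ‖h z‖ ^ p) (Metric.closedBall c δ) :=
    hh.continuousOn.norm.rpow_const fun _ _ => Or.inr hp.le
  set S : Set (ℝ × ℝ) := Set.Ioo 0 δ ×ˢ Set.Ioo (-Real.pi) Real.pi with hS
  have hSm : MeasurableSet S := measurableSet_Ioo.prod measurableSet_Ioo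
  set G : ℝ × ℝ → ℝ := fun x => x.1 * ‖h (circleMap c x.1 x.2)‖ ^ p with hG
  have hmaps : ∀ x ∈ S, circleMap c x.1 x.2 ∈ Metric.closedBall c δ := by
    rintro ⟨s, θ⟩ ⟨hs, -⟩
    have hs' : 0 < s ∧ s < δ := hs
    simpa [dist_eq_norm, abs_of_pos hs'.1] using hs'.2.le
  have hGcont : ContinuousOn G S := by
    refine continuousOn_fst.mul (hcontb.comp (f := fun x : ℝ × ℝ => circleMap c x.1 x.2) ?_ hmaps)
    unfold circleMap
    fun_prop
  have hpolar : ∫⁻ x in S, ENNReal.ofReal (G x)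
      ≤ ∫⁻ z in Metric.ball c δ, ENNReal.ofReal (‖h z‖ ^ p) := by
    rw [← lintegral_indicator measurableSet_ball,
      ← lintegral_add_left_eq_self _ c, ← Complex.lintegral_comp_polarCoord_symm]
    have hST : S ⊆ polarCoord.target :=
      Set.prod_mono (fun x hx => hx.1) subset_rfl
    refine le_trans (le_of_eq ?_) (lintegral_mono_set hST)
    refine setLIntegral_congr_fun hSm fun x hx => ?_
    have hx1 : 0 < x.1 ∧ x.1 < δ := hx.1
    have hcm : c + Complex.polarCoord.symm x = circleMap c x.1 x.2 := by
      simp [circleMap, Complex.exp_mul_I]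
    rw [hcm, Set.indicator_of_mem (by simpa [dist_eq_norm, abs_of_pos hx1.1] using hx1.2), hG,
      ENNReal.ofReal_mul hx1.1.le, smul_eq_mul]
  refine le_trans ?_ hpolar
  rw [hS, Measure.volume_eq_prod, ← Measure.prod_restrict, lintegral_prod _ (by
    rw [Measure.prod_restrict, ← Measure.volume_eq_prod]
    exact (hGcont.aemeasurable hSm).ennreal_ofReal)]
  have hinner : ∀ s ∈ Set.Ioo 0 δ, ENNReal.ofReal (s * (2 * Real.pi * ‖h c‖ ^ p))
      ≤ ∫⁻ θ in Set.Ioo (-Real.pi) Real.pi, ENNReal.ofReal (G (s, θ)) := by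
    intro s hs
    have hss : Metric.closedBall c s ⊆ Metric.closedBall c δ :=
      Metric.closedBall_subset_closedBall hs.2.le
    have hc : Continuous fun θ => ‖h (circleMap c s θ)‖ ^ p := by
      refine hcontb.comp_continuous (by fun_prop) fun θ => ?_
      simpa [dist_eq_norm, abs_of_pos hs.1] using hs.2.le
    rw [restrict_Ioo_eq_restrict_Ioc, lintegral_Ioc_ofReal (by linarith [Real.pi_pos])
      ((hc.const_mul s).intervalIntegrable _ _) fun θ _ => mul_nonneg hs.1.le (by positivity)]
    apply ENNReal.ofReal_le_ofReal
    have h1 := norm_rpow_le_circleAverage hp hs.1 (hh.mono hss)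
    have hper : Function.Periodic (fun θ => ‖h (circleMap c s θ)‖ ^ p) (2 * Real.pi) :=
      fun θ => by simp [periodic_circleMap c s θ]
    have h2 := hper.intervalIntegral_add_eq 0 (-Real.pi)
    rw [zero_add, show -Real.pi + 2 * Real.pi = Real.pi by ring] at h2
    rw [Real.circleAverage_def, smul_eq_mul, h2] at h1
    rw [intervalIntegral.integral_const_mul]
    refine mul_le_mul_of_nonneg_left ?_ hs.1.le
    rwa [inv_mul_eq_div, le_div_iff₀ Real.two_pi_pos, mul_comm] at h1
  calc _ = ∫⁻ s in Set.Ioo 0 δ, ENNReal.ofReal (s * (2 * Real.pi * ‖h c‖ ^ p)) := by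
        rw [restrict_Ioo_eq_restrict_Ioc, lintegral_Ioc_ofReal hδ.le
            (Continuous.intervalIntegrable (by fun_prop) _ _)
            fun x hx => mul_nonneg hx.1.le (by positivity),
          intervalIntegral.integral_mul_const, integral_id,
          ← ENNReal.ofReal_mul (by positivity)]
        congr 1
        ring
    _ ≤ _ := setLIntegral_mono' measurableSet_Ioo hinner

/-- `‖f‖ ^ p` at a point is controlled by its integral over a logarithmic polar rectangle. -/
lemma norm_rpow_mul_area_le_rectangle {p δ A B α β θ : ℝ} (hp : 0 < p) (hδ : 0 < δ)
    (hB : B + δ < 0) {f : ℂ → ℂ} (hf : DifferentiableOn ℂ f (Metric.ball 0 1)) {w : ℂ}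
    (hA : Real.exp A ≤ ‖w‖) (hwB : ‖w‖ ≤ Real.exp B) (hα : α ≤ θ) (hβ : θ ≤ β)
    (hw : w = (‖w‖ : ℂ) * Complex.exp ((θ : ℂ) * Complex.I)) :
    ENNReal.ofReal (‖f w‖ ^ p) * ENNReal.ofReal (Real.pi * δ ^ 2)
      ≤ ∫⁻ x in Set.Icc (A - δ) (B + δ), ∫⁻ y in Set.Icc (α - δ) (β + δ),
          ENNReal.ofReal (‖f (circleMap 0 (Real.exp x) y)‖ ^ p) := by
  have hw0 : 0 < ‖w‖ := (Real.exp_pos A).trans_le hA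
  set ζ : ℂ := ⟨Real.log ‖w‖, θ⟩ with hζ
  have hζA : A ≤ Real.log ‖w‖ := (Real.le_log_iff_exp_le hw0).2 hA
  have hζB : Real.log ‖w‖ ≤ B := (Real.log_le_iff_le_exp hw0).2 hwB
  have hexp : Complex.exp ζ = w := by
    have : ζ = (Real.log ‖w‖ : ℂ) + θ * Complex.I := by
      apply Complex.ext <;> simp [hζ]
    rw [this, Complex.exp_add, ← Complex.ofReal_exp, Real.exp_log hw0]
    exact hw.symm
  have hmem : ∀ z : ℂ, z.re ≤ B + δ → Complex.exp z ∈ Metric.ball (0:ℂ) 1 := fun z hz => by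
    rw [mem_ball_zero_iff, Complex.norm_exp]
    exact Real.exp_lt_one_iff.2 (hz.trans_lt hB)
  have hana : AnalyticOnNhd ℂ (fun z => f (Complex.exp z)) (Metric.closedBall ζ δ) := by
    intro z hz
    have hzr : z.re ≤ B + δ := by
      have h1 := Complex.re_le_norm (z - ζ)
      rw [Metric.mem_closedBall, dist_eq_norm] at hz
      simp only [Complex.sub_re, hζ] at h1
      simp only [hζ] at hz
      linarith
    exact ((hf.analyticOnNhd Metric.isOpen_ball) _ (hmem z hzr)).fun_comp (f := Complex.exp)
      (by fun_prop)
  have h1 := norm_rpow_mul_area_le hp hδ hana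
  rw [hexp] at h1
  refine h1.trans ?_
  set P : Set (ℝ × ℝ) := Set.Icc (A - δ) (B + δ) ×ˢ Set.Icc (α - δ) (β + δ) with hP
  have hPm : MeasurableSet P := measurableSet_Icc.prod measurableSet_Icc
  have hcm : ∀ x : ℝ × ℝ, Complex.exp (Complex.measurableEquivRealProd.symm x)
      = circleMap 0 (Real.exp x.1) x.2 := fun x => by
    have : Complex.measurableEquivRealProd.symm x = (x.1 : ℂ) + x.2 * Complex.I := by
      apply Complex.ext <;> simp [Complex.measurableEquivRealProd_symm_apply]
    rw [this, Complex.exp_add, circleMap, zero_add, Complex.ofReal_exp]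
  have hcont : ContinuousOn (fun x : ℝ × ℝ => ‖f (circleMap 0 (Real.exp x.1) x.2)‖ ^ p) P := by
    refine ((hf.continuousOn.norm.rpow_const fun _ _ => Or.inr hp.le).comp
      (f := fun x : ℝ × ℝ => circleMap 0 (Real.exp x.1) x.2) (t := Metric.ball 0 1) ?_ ?_)
    · unfold circleMap
      fun_prop
    · intro x hx
      rw [mem_ball_zero_iff]
      simpa using hx.1.2.trans_lt hB
  calc ∫⁻ z in Metric.ball ζ δ, ENNReal.ofReal (‖f (Complex.exp z)‖ ^ p)
      ≤ ∫⁻ x in P, ENNReal.ofReal (‖f (circleMap 0 (Real.exp x.1) x.2)‖ ^ p) := by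
        rw [← lintegral_indicator measurableSet_ball, ← lintegral_indicator hPm,
          ← (Complex.volume_preserving_equiv_real_prod.symm).lintegral_comp_emb
            Complex.measurableEquivRealProd.symm.measurableEmbedding]
        refine lintegral_mono fun x => ?_
        by_cases hx : Complex.measurableEquivRealProd.symm x ∈ Metric.ball ζ δ
        · have hxP : x ∈ P := by
            rw [mem_ball_iff_norm] at hx
            have h2 := (Complex.abs_re_le_norm _).trans hx.le
            have h3 := (Complex.abs_im_le_norm _).trans hx.le
            rw [abs_le] at h2 h3
            simp [Complex.measurableEquivRealProd_symm_apply, hζ] at h2 h3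
            refine ⟨⟨?_, ?_⟩, ⟨?_, ?_⟩⟩ <;> linarith
          rw [Set.indicator_of_mem hx, Set.indicator_of_mem hxP, hcm]
        · rw [Set.indicator_of_notMem hx]
          exact zero_le
    _ = _ := by
        rw [hP, Measure.volume_eq_prod, ← Measure.prod_restrict, lintegral_prod]
        rw [Measure.prod_restrict, ← Measure.volume_eq_prod]
        exact (hcont.aemeasurable hPm).ennreal_ofReal

/-- The integrals of a periodic function over `N` equally spaced intervals, each three times as
long as the spacing, add up to three times the integral over a period. -/
lemma sum_integral_overlapping_intervals {ψ : ℝ → ℝ} {T : ℝ} (hψ : Continuous ψ)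
    (hper : Function.Periodic ψ T) {N : ℕ} (hN : 0 < N) :
    ∑ l ∈ Finset.range N, ∫ y in (T * ((l:ℝ) - 1) / N)..(T * ((l:ℝ) + 2) / N), ψ y
      = 3 * ∫ y in (0:ℝ)..T, ψ y := by
  have hN' : (N:ℝ) ≠ 0 := by positivity
  have hintegrable : ∀ a b, IntervalIntegrable ψ volume a b := fun a b => hψ.intervalIntegrable a b
  have key : ∀ i : ℝ, ∑ l ∈ Finset.range N, ∫ y in (T * (l + i) / N)..(T * (l + i + 1) / N), ψ y
      = ∫ y in (0:ℝ)..T, ψ y := by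
    intro i
    have h1 := intervalIntegral.sum_integral_adjacent_intervals (f := ψ) (μ := volume) (n := N)
      (a := fun k : ℕ => T * (k + i) / N) fun k _ => hintegrable _ _
    have h2 := hper.intervalIntegral_add_eq (T * i / N) 0
    have h3 : T * (N + i) / N = T * i / N + T := by field_simp; ring
    simp only [Nat.cast_zero, zero_add, h3] at h1 h2
    rw [← h2, ← h1]
    refine Finset.sum_congr rfl fun l _ => ?_
    push_cast
    ring_nf
  have hsplit : ∀ l : ℕ, ∫ y in (T * ((l:ℝ) - 1) / N)..(T * ((l:ℝ) + 2) / N), ψ y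
      = (∫ y in (T * (l + (-1)) / N)..(T * (l + (-1) + 1) / N), ψ y)
        + (∫ y in (T * (l + 0) / N)..(T * (l + 0 + 1) / N), ψ y)
        + ∫ y in (T * (l + 1) / N)..(T * (l + 1 + 1) / N), ψ y := by
    intro l
    rw [show (l:ℝ) + (-1) + 1 = l + 0 by ring, show (l:ℝ) + 0 + 1 = l + 1 by ring,
      intervalIntegral.integral_add_adjacent_intervals (hintegrable _ _) (hintegrable _ _),
      intervalIntegral.integral_add_adjacent_intervals (hintegrable _ _) (hintegrable _ _)]
    ring_nf
  rw [Finset.sum_congr rfl fun l _ => hsplit l, Finset.sum_add_distrib, Finset.sum_add_distrib,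
    key, key, key]
  ring

lemma sum_lintegral_le_lintegral_sum {ι X : Type*} [MeasurableSpace X] (μ : Measure X)
    (s : Finset ι) (g : ι → X → ℝ≥0∞) :
    ∑ i ∈ s, ∫⁻ x, g i x ∂μ ≤ ∫⁻ x, ∑ i ∈ s, g i x ∂μ := by
  classical
  induction s using Finset.induction_on with
  | empty => simp
  | insert i s hi ih =>
    simp only [Finset.sum_insert hi]
    exact (add_le_add_right ih _).trans (le_lintegral_add _ _)

/-- Discretised means of `‖f‖ ^ p` over a family of polar rectangles are controlled by the mean
over a larger circle. -/
lemma sum_iSup_norm_rpow_le {p A B : ℝ} {N : ℕ} (hp : 0 < p) (hN : 0 < N)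
    (hB : B + 1 / N < 0) {f : ℂ → ℂ} (hf : DifferentiableOn ℂ f (Metric.ball 0 1))
    (S : ℕ → Set ℂ)
    (hS : ∀ l, ∀ w ∈ S l, Real.exp A ≤ ‖w‖ ∧ ‖w‖ ≤ Real.exp B ∧
      ∃ θ : ℝ, 2 * Real.pi * l / N ≤ θ ∧ θ ≤ 2 * Real.pi * (l + 1) / N ∧
        w = (‖w‖ : ℂ) * Complex.exp ((θ : ℂ) * Complex.I)) :
    ∑ l ∈ Finset.range N, (⨆ w ∈ S l, ENNReal.ofReal ‖f w‖) ^ p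
      ≤ ENNReal.ofReal (6 * N ^ 2 * (B - A + 2 / N) *
          Real.circleAverage (fun w => ‖f w‖ ^ p) 0 (Real.exp (B + 1 / N))) := by
  set J := Real.circleAverage (fun w => ‖f w‖ ^ p) 0 with hJ
  have hNr : (0:ℝ) < N := by exact_mod_cast hN
  set δ : ℝ := 1 / N with hδ
  have hδ0 : 0 < δ := by positivity
  have hδπ : δ ≤ 2 * Real.pi / N := by
    rw [hδ]; gcongr; linarith [Real.pi_gt_three]
  have hT := Real.two_pi_pos
  set c : ℝ≥0∞ := ENNReal.ofReal (Real.pi * δ ^ 2) with hc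
  have hcr : 0 < Real.pi * δ ^ 2 := by positivity
  have hc0 : c ≠ 0 := by rw [hc]; simpa using hcr
  have hct : c ≠ ⊤ := ENNReal.ofReal_ne_top
  set X := Set.Icc (A - δ) (B + δ) with hX
  set Y : ℕ → Set ℝ := fun l =>
    Set.Icc (2 * Real.pi * ((l:ℝ) - 1) / N) (2 * Real.pi * ((l:ℝ) + 2) / N) with hY
  set φ : ℝ → ℝ → ℝ := fun x y => ‖f (circleMap 0 (Real.exp x) y)‖ ^ p with hφ
  have hone : ∀ l, (⨆ w ∈ S l, ENNReal.ofReal ‖f w‖) ^ p * c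
      ≤ ∫⁻ x in X, ∫⁻ y in Y l, ENNReal.ofReal (φ x y) := by
    intro l
    rw [← ENNReal.le_div_iff_mul_le (Or.inl hc0) (Or.inl hct), ← ENNReal.le_rpow_inv_iff hp]
    refine iSup₂_le fun w hw => ?_
    rw [ENNReal.le_rpow_inv_iff hp, ENNReal.le_div_iff_mul_le (Or.inl hc0) (Or.inl hct),
      ENNReal.ofReal_rpow_of_nonneg (norm_nonneg _) hp.le]
    obtain ⟨h1, h2, θ, h3, h4, h5⟩ := hS l w hw
    refine (norm_rpow_mul_area_le_rectangle hp hδ0 hB hf h1 h2 h3 h4 h5).trans ?_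
    refine lintegral_mono fun x => lintegral_mono_set (Set.Icc_subset_Icc ?_ ?_)
    · have : 2 * Real.pi * ((l:ℝ) - 1) / N = 2 * Real.pi * l / N - 2 * Real.pi / N := by ring
      linarith
    · have : 2 * Real.pi * ((l:ℝ) + 2) / N
          = 2 * Real.pi * (l + 1) / N + 2 * Real.pi / N := by ring
      linarith
  have hinner : ∀ x ∈ X, ∑ l ∈ Finset.range N, ∫⁻ y in Y l, ENNReal.ofReal (φ x y)
      ≤ ENNReal.ofReal (6 * Real.pi * J (Real.exp (B + δ))) := by
    intro x hx
    have hcont : Continuous (φ x) := by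
      refine (hf.continuousOn.norm.rpow_const fun _ _ => Or.inr hp.le).comp_continuous
        (s := Metric.ball 0 1) (f := circleMap 0 (Real.exp x)) (by fun_prop) fun y => ?_
      rw [mem_ball_zero_iff]
      simpa using hx.2.trans_lt hB
    have hper : Function.Periodic (φ x) (2 * Real.pi) :=
      fun y => by simp [hφ, periodic_circleMap 0 (Real.exp x) y]
    have hnn : ∀ y, 0 ≤ φ x y := fun y => by positivity
    have hle : ∀ l : ℕ, 2 * Real.pi * ((l:ℝ) - 1) / N ≤ 2 * Real.pi * ((l:ℝ) + 2) / N :=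
      fun l => by gcongr; linarith
    have h1 : ∀ l : ℕ, ∫⁻ y in Y l, ENNReal.ofReal (φ x y) = ENNReal.ofReal
        (∫ y in (2 * Real.pi * ((l:ℝ) - 1) / N)..(2 * Real.pi * ((l:ℝ) + 2) / N), φ x y) := by
      intro l
      rw [hY, ← restrict_Ioc_eq_restrict_Icc,
        lintegral_Ioc_ofReal (hle l) (hcont.intervalIntegrable _ _) fun y _ => hnn y]
    rw [Finset.sum_congr rfl fun l _ => h1 l, ← ENNReal.ofReal_sum_of_nonneg fun l _ =>
      intervalIntegral.integral_nonneg (hle l) fun y _ => hnn y,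
      sum_integral_overlapping_intervals hcont hper hN]
    apply ENNReal.ofReal_le_ofReal
    have h2 := circleAverage_norm_rpow_mono hp hf (Real.exp_pos x).le
      (Real.exp_le_exp.2 hx.2) (Real.exp_lt_one_iff.2 hB)
    rw [← hJ, hJ, Real.circleAverage_def, ← hJ, smul_eq_mul, inv_mul_le_iff₀ hT] at h2
    linarith
  have hsum : (∑ l ∈ Finset.range N, (⨆ w ∈ S l, ENNReal.ofReal ‖f w‖) ^ p) * c
      ≤ ENNReal.ofReal (6 * Real.pi * J (Real.exp (B + δ))) * ENNReal.ofReal (B - A + 2 * δ) := by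
    rw [Finset.sum_mul]
    refine (Finset.sum_le_sum fun l _ => hone l).trans
      ((sum_lintegral_le_lintegral_sum _ _ _).trans
        ((setLIntegral_mono' measurableSet_Icc hinner).trans (le_of_eq ?_)))
    rw [setLIntegral_const, Real.volume_Icc]
    ring_nf
  have hJ0 : 0 ≤ J (Real.exp (B + δ)) := circleAverage_norm_rpow_nonneg p f _
  rw [← ENNReal.le_div_iff_mul_le (Or.inl hc0) (Or.inl hct)] at hsum
  refine hsum.trans (le_of_eq ?_)
  rw [← ENNReal.ofReal_mul (by positivity), hc, ← ENNReal.ofReal_div_of_pos hcr, hδ]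
  congr 1
  field_simp

section Radii

variable {K : ℕ}

lemma rK_nonneg (hK : 2 ≤ K) (j : ℕ) : 0 ≤ rK K j := by
  have h1 : (1:ℝ) ≤ (K:ℝ) ^ j := one_le_pow₀ (by exact_mod_cast (by omega : 1 ≤ K))
  exact sub_nonneg.2 (inv_le_one_of_one_le₀ h1)

lemma rK_lt_one (hK : 2 ≤ K) (j : ℕ) : rK K j < 1 := by
  have : 0 < ((K:ℝ) ^ j)⁻¹ := by positivity
  unfold rK
  linarith

lemma rK_monotone (hK : 2 ≤ K) : Monotone (rK K) := by
  refine fun i j hij => sub_le_sub_left ?_ 1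
  have h1 : (1:ℝ) ≤ K := by exact_mod_cast (by omega : 1 ≤ K)
  gcongr

lemma half_le_rK (hK : 2 ≤ K) (j : ℕ) : 1 / 2 ≤ rK K (j + 1) := by
  refine le_trans ?_ (rK_monotone hK (Nat.le_add_left 1 j))
  have h2 : (2:ℝ) ≤ K := by exact_mod_cast hK
  have : (K:ℝ)⁻¹ ≤ 2⁻¹ := by gcongr
  unfold rK
  rw [pow_one]
  linarith

lemma one_sub_one_sub_rK_div (j : ℕ) : 1 - (1 - rK K j) / K = rK K (j + 1) := by
  unfold rK
  rw [pow_succ, mul_inv]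
  ring

lemma rK_succ_mul_exp_le (hK : 2 ≤ K) (j : ℕ) :
    rK K (j + 1) * Real.exp (1 / (K ^ (j + 3) : ℕ)) ≤ rK K (j + 2) := by
  have hKr : (2:ℝ) ≤ K := by exact_mod_cast hK
  set k : ℝ := (K:ℝ)⁻¹ with hk
  have hk0 : 0 < k := by positivity
  have hk2 : k ≤ 1 / 2 := by
    rw [hk, one_div]; gcongr
  set s : ℝ := ((K:ℝ) ^ (j + 1))⁻¹ with hs
  have hs0 : 0 < s := by positivity
  have e1 : rK K (j + 2) = 1 - s * k := by
    simp only [rK, hs, hk, pow_succ, mul_inv]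
  have e2 : 1 / ((K ^ (j + 3) : ℕ) : ℝ) = s * k * k := by
    rw [Nat.cast_pow]
    simp only [hs, hk, pow_succ, one_div, mul_inv]
  rw [e1, e2, show rK K (j + 1) = 1 - s from rfl]
  have h1 := Real.one_sub_le_exp_neg (s * k * k)
  have hs1 : s ≤ 1 := by
    have := rK_nonneg hK (j + 1)
    change 0 ≤ 1 - s at this
    linarith
  have h2 : 1 - s ≤ (1 - s * k) * Real.exp (-(s * k * k)) := by
    refine le_trans ?_ (mul_le_mul_of_nonneg_left h1 (by nlinarith))
    nlinarith [mul_pos hs0 hk0, mul_pos (mul_pos hs0 hk0) hk0,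
      mul_pos (mul_pos (mul_pos hs0 hk0) hk0) (mul_pos hs0 hk0)]
  calc (1 - s) * Real.exp (s * k * k)
      ≤ (1 - s * k) * Real.exp (-(s * k * k)) * Real.exp (s * k * k) := by gcongr
    _ = 1 - s * k := by rw [mul_assoc, ← Real.exp_add, neg_add_cancel, Real.exp_zero, mul_one]

lemma exists_rK_le_lt (hK : 2 ≤ K) {r : ℝ} (h0 : 0 ≤ r) (h1 : r < 1) :
    ∃ j, rK K j ≤ r ∧ r < rK K (j + 1) := by
  have hr : 0 < 1 - r := sub_pos.2 h1
  obtain ⟨j, hj1, hj2⟩ := exists_nat_pow_near (x := (1 - r)⁻¹) (y := (K:ℝ))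
    ((one_le_inv₀ hr).2 (by linarith)) (by exact_mod_cast hK)
  have hKr : (0:ℝ) < K := by exact_mod_cast (by omega : 0 < K)
  refine ⟨j, ?_, ?_⟩
  · have := (le_inv_comm₀ (by positivity) hr).1 hj1
    unfold rK
    linarith
  · have := (inv_lt_comm₀ hr (by positivity)).1 hj2
    unfold rK
    linarith

end Radii

/-- Any complex number has an argument lying in one of `N` given equal sectors. -/
lemma exists_sector {N : ℕ} (hN : 0 < N) (z : ℂ) :
    ∃ l < N, ∃ θ : ℝ, 2 * Real.pi * l / N ≤ θ ∧ θ ≤ 2 * Real.pi * (l + 1) / N ∧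
      z = (‖z‖ : ℂ) * Complex.exp ((θ : ℂ) * Complex.I) := by
  have hT := Real.two_pi_pos
  have hNr : (0:ℝ) < N := by exact_mod_cast hN
  obtain ⟨θ, h0, h1, h2⟩ : ∃ θ : ℝ, 0 ≤ θ ∧ θ < 2 * Real.pi ∧
      z = (‖z‖ : ℂ) * Complex.exp ((θ : ℂ) * Complex.I) := by
    rcases le_or_gt 0 z.arg with h | h
    · exact ⟨z.arg, h, by linarith [Complex.arg_le_pi z], (Complex.norm_mul_exp_arg_mul_I z).symm⟩
    · refine ⟨z.arg + 2 * Real.pi, by linarith [Complex.neg_pi_lt_arg z], by linarith, ?_⟩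
      push_cast
      rw [add_mul, Complex.exp_add, Complex.exp_two_pi_mul_I, mul_one,
        Complex.norm_mul_exp_arg_mul_I]
  refine ⟨⌊θ * N / (2 * Real.pi)⌋₊, ?_, θ, ?_, ?_, h2⟩
  · rw [Nat.floor_lt (by positivity), div_lt_iff₀ hT]
    nlinarith
  · have := Nat.floor_le (a := θ * N / (2 * Real.pi)) (by positivity)
    rw [le_div_iff₀ hT] at this
    rw [div_le_iff₀ hNr]
    linarith
  · have := (Nat.lt_floor_add_one (θ * N / (2 * Real.pi))).le
    rw [div_le_iff₀ hT] at this
    rw [le_div_iff₀ hNr]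
    linarith

/-- The row of suprema over `Q_{j,l}` is controlled by the mean on the circle of radius
`r_{j+2}`. -/
lemma sum_iSup_Qset_le {p : ℝ} (hp : 0 < p) {K : ℕ} (hK : 2 ≤ K) {f : ℂ → ℂ}
    (hf : DifferentiableOn ℂ f (Metric.ball 0 1)) (j : ℕ) :
    ∑ l ∈ Finset.range (K ^ (j + 3)), (⨆ w ∈ Qset K j l, ENNReal.ofReal ‖f w‖) ^ p
      ≤ ENNReal.ofReal (24 * K ^ 6 * K ^ j *
          Real.circleAverage (fun w => ‖f w‖ ^ p) 0 (rK K (j + 2))) := by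
  have hKr : (2:ℝ) ≤ K := by exact_mod_cast hK
  have hN : 0 < K ^ (j + 3) := by positivity
  have hr1 : 0 < rK K (j + 1) := lt_of_lt_of_le (by norm_num) (half_le_rK hK j)
  set B := Real.log (rK K (j + 1)) with hBdef
  have hexpB : Real.exp B = rK K (j + 1) := Real.exp_log hr1
  set N := K ^ (j + 3) with hNdef
  have hρ : Real.exp (B + 1 / (N : ℝ)) ≤ rK K (j + 2) := by
    rw [Real.exp_add, hexpB]
    exact rK_succ_mul_exp_le hK j
  have hBN : B + 1 / (N : ℝ) < 0 := Real.exp_lt_one_iff.1 (hρ.trans_lt (rK_lt_one hK _))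
  have hJle := circleAverage_norm_rpow_mono hp hf (Real.exp_pos _).le hρ (rK_lt_one hK _)
  have hJ0 := circleAverage_norm_rpow_nonneg p f (Real.exp (B + 1 / (N : ℝ)))
  have hNr : (N : ℝ) = K ^ j * K ^ 3 := by rw [hNdef]; push_cast; ring
  rcases Nat.eq_zero_or_pos j with rfl | hj
  · set r := rK K (0 + 1) with hr
    obtain ⟨z, hz, hmax⟩ := Complex.exists_mem_frontier_isMaxOn_norm (f := f)
      (U := Metric.ball (0:ℂ) r) Metric.isBounded_ball ⟨0, Metric.mem_ball_self hr1⟩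
      ((hf.mono (by
        rw [closure_ball _ hr1.ne']
        exact Metric.closedBall_subset_ball (rK_lt_one hK _))).diffContOnCl)
    rw [frontier_ball _ hr1.ne', mem_sphere_zero_iff_norm] at hz
    rw [closure_ball _ hr1.ne'] at hmax
    obtain ⟨l₀, hl₀, hθ⟩ := exists_sector hN z
    have h1 := sum_iSup_norm_rpow_le hp hN hBN hf
      (fun l => {w : ℂ | Real.exp B ≤ ‖w‖ ∧ ‖w‖ ≤ Real.exp B ∧
        ∃ θ : ℝ, 2 * Real.pi * l / N ≤ θ ∧ θ ≤ 2 * Real.pi * (l + 1) / N ∧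
          w = (‖w‖ : ℂ) * Complex.exp ((θ : ℂ) * Complex.I)}) (fun l w hw => hw)
    have h2 : ENNReal.ofReal ‖f z‖ ^ p ≤ ENNReal.ofReal (12 * N *
        Real.circleAverage (fun w => ‖f w‖ ^ p) 0 (rK K (0 + 2))) := by
      refine le_trans ?_ ((Finset.single_le_sum (fun _ _ => zero_le)
        (Finset.mem_range.2 hl₀)).trans (h1.trans (ENNReal.ofReal_le_ofReal ?_)))
      · refine ENNReal.rpow_le_rpow ?_ hp.le
        exact le_iSup₂_of_le z ⟨by rw [hexpB, hz], by rw [hexpB, hz], hθ⟩ le_rfl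
      · have hN0 : (N : ℝ) ≠ 0 := by positivity
        have e : 6 * (N:ℝ) ^ 2 * (B - B + 2 / N) = 12 * N := by field_simp; ring
        rw [e]
        gcongr
    have h3 : ∀ l ∈ Finset.range N, (⨆ w ∈ Qset K 0 l, ENNReal.ofReal ‖f w‖) ^ p
        ≤ ENNReal.ofReal ‖f z‖ ^ p := by
      refine fun l _ => ENNReal.rpow_le_rpow (iSup₂_le fun w hw => ?_) hp.le
      refine ENNReal.ofReal_le_ofReal (hmax ?_)
      rw [mem_closedBall_zero_iff]
      exact hw.2.1.le
    refine (Finset.sum_le_sum h3).trans ?_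
    rw [Finset.sum_const, Finset.card_range, nsmul_eq_mul]
    refine (mul_le_mul_right h2 _).trans ?_
    rw [← ENNReal.ofReal_natCast, ← ENNReal.ofReal_mul (by positivity)]
    apply ENNReal.ofReal_le_ofReal
    have hJ2 : 0 ≤ Real.circleAverage (fun w => ‖f w‖ ^ p) 0 (rK K (0 + 2)) := hJ0.trans hJle
    rw [hNr, ← mul_assoc]
    refine mul_le_mul_of_nonneg_right ?_ hJ2
    have : (0:ℝ) ≤ K ^ 6 := by positivity
    nlinarith
  · obtain ⟨i, rfl⟩ : ∃ i, j = i + 1 := ⟨j - 1, by omega⟩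
    have hr0 := half_le_rK hK i
    have hr0' : 0 < rK K (i + 1) := by linarith
    set A := Real.log (rK K (i + 1)) with hAdef
    have hBA : B - A ≤ 2 * ((K:ℝ) ^ (i + 1))⁻¹ := by
      rw [hBdef, hAdef, ← Real.log_div hr1.ne' hr0'.ne']
      refine (Real.log_le_sub_one_of_pos (by positivity)).trans ?_
      rw [div_sub_one hr0'.ne', div_le_iff₀ hr0']
      have h1 := rK_lt_one hK (i + 1 + 1)
      have h2 : rK K (i + 1) = 1 - ((K:ℝ) ^ (i + 1))⁻¹ := rfl
      have h3 : 0 < ((K:ℝ) ^ (i + 1))⁻¹ := by positivity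
      nlinarith
    have h1 := sum_iSup_norm_rpow_le hp hN hBN hf (fun l => Qset K (i + 1) l) (by
      rintro l w ⟨hw1, hw2, θ, hθ1, hθ2, hθ3⟩
      refine ⟨by rwa [Real.exp_log hr0'], by rw [hexpB]; exact hw2.le, θ, ?_, ?_, hθ3⟩
      · rw [hNdef]; push_cast; exact hθ1
      · rw [hNdef]; push_cast; exact hθ2.le)
    refine h1.trans (ENNReal.ofReal_le_ofReal ?_)
    refine mul_le_mul ?_ hJle hJ0 (by positivity)
    have hN0 : (0 : ℝ) < N := by positivity
    have hk : (0:ℝ) < K ^ (i + 1) := by positivity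
    have h2N : 2 / (N:ℝ) ≤ 2 * ((K:ℝ) ^ (i + 1))⁻¹ := by
      rw [div_eq_mul_inv, hNr, mul_inv]
      have : ((K:ℝ) ^ 3)⁻¹ ≤ 1 := inv_le_one_of_one_le₀ (one_le_pow₀ (by linarith))
      have h3 : 0 < ((K:ℝ) ^ (i + 1))⁻¹ := by positivity
      nlinarith
    calc 6 * (N:ℝ) ^ 2 * (B - A + 2 / N)
        ≤ 6 * (N:ℝ) ^ 2 * (2 * ((K:ℝ) ^ (i + 1))⁻¹ + 2 * ((K:ℝ) ^ (i + 1))⁻¹) := by gcongr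
      _ = 24 * (K:ℝ) ^ 6 * (K:ℝ) ^ (i + 1) := by
          rw [hNr]
          field_simp
          ring

section Weight

variable {ω : ℝ → ℝ}

lemma RadialWeight.intervalIntegrable (hω : RadialWeight ω) {a b : ℝ} (ha : 0 ≤ a) (hab : a ≤ b)
    (hb : b ≤ 1) : IntervalIntegrable ω volume a b := by
  refine hω.2.mono_set ?_
  rw [Set.uIcc_of_le hab, Set.uIcc_of_le zero_le_one]
  exact Set.Icc_subset_Icc ha hb

lemma RadialWeight.wh_nonneg (hω : RadialWeight ω) {r : ℝ} (hr : r ≤ 1) : 0 ≤ wh ω r :=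
  intervalIntegral.integral_nonneg hr fun s _ => hω.1 s

lemma RadialWeight.lintegral_Ioc (hω : RadialWeight ω) {a b : ℝ} (ha : 0 ≤ a) (hab : a ≤ b)
    (hb : b ≤ 1) :
    ∫⁻ s in Set.Ioc a b, ENNReal.ofReal (ω s) = ENNReal.ofReal (wh ω a - wh ω b) := by
  rw [lintegral_Ioc_ofReal hab (hω.intervalIntegrable ha hab hb) fun s _ => hω.1 s]
  congr 1
  rw [eq_sub_iff_add_eq]
  exact intervalIntegral.integral_add_adjacent_intervals (hω.intervalIntegrable ha hab hb)
    (hω.intervalIntegrable (ha.trans hab) hb le_rfl)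

lemma RadialWeight.wh_anti (hω : RadialWeight ω) {a b : ℝ} (ha : 0 ≤ a) (hab : a ≤ b)
    (hb : b ≤ 1) : wh ω b ≤ wh ω a := by
  have h := intervalIntegral.integral_add_adjacent_intervals (hω.intervalIntegrable ha hab hb)
    (hω.intervalIntegrable (ha.trans hab) hb le_rfl)
  have h0 : 0 ≤ ∫ s in a..b, ω s := intervalIntegral.integral_nonneg hab fun s _ => hω.1 s
  unfold wh
  linarith

/-- Iterating the doubling condition. -/
lemma wh_le_pow_mul {C : ℝ} (hC : 1 ≤ C)
    (h : ∀ r : ℝ, 0 ≤ r → r < 1 → wh ω r ≤ C * wh ω ((1 + r) / 2)) (m : ℕ) {r : ℝ}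
    (h0 : 0 ≤ r) (h1 : r < 1) : wh ω r ≤ C ^ m * wh ω (1 - (1 - r) / 2 ^ m) := by
  induction m with
  | zero => simp
  | succ m ih =>
    have hm : (1:ℝ) ≤ 2 ^ m := one_le_pow₀ one_le_two
    have hpos : 0 < (1 - r) / 2 ^ m := div_pos (by linarith) (by positivity)
    have hle : (1 - r) / 2 ^ m ≤ 1 := by
      rw [div_le_one (by positivity)]
      linarith
    refine ih.trans ?_
    rw [pow_succ, mul_assoc]
    refine mul_le_mul_of_nonneg_left ?_ (by positivity)
    refine (h _ (by linarith) (by linarith)).trans (le_of_eq ?_)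
    congr 2
    rw [pow_succ]
    field_simp
    ring

lemma exists_wh_rK_le (hω : RadialWeight ω) (hD : Dhat ω) {K : ℕ} (hK : 2 ≤ K) {C0 : ℝ}
    (hC0 : 1 < C0) (hKω : ∀ r : ℝ, 0 ≤ r → r < 1 → C0 * wh ω (1 - (1 - r) / K) ≤ wh ω r) :
    ∃ C : ℝ, 0 ≤ C ∧ ∀ j, wh ω (rK K j) ≤ C * (wh ω (rK K (j + 2)) - wh ω (rK K (j + 3))) := by
  obtain ⟨C, hC, h⟩ := hD
  obtain ⟨m, hm⟩ := pow_unbounded_of_one_lt ((K:ℝ) ^ 2) one_lt_two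
  have hKr : (0:ℝ) < K := by exact_mod_cast (by omega : 0 < K)
  have hC' : 0 < 1 - 1 / C0 := by
    rw [sub_pos, div_lt_one (by linarith)]
    exact hC0
  refine ⟨C ^ m * (1 - 1 / C0)⁻¹, by positivity, fun j => ?_⟩
  have h1 := wh_le_pow_mul hC h m (rK_nonneg hK j) (rK_lt_one hK j)
  have hle : rK K (j + 2) ≤ 1 - (1 - rK K j) / 2 ^ m := by
    have e : rK K (j + 2) = 1 - (1 - rK K j) / (K:ℝ) ^ 2 := by
      unfold rK
      rw [pow_add, mul_inv]
      ring
    have := rK_lt_one hK j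
    rw [e]
    gcongr
  have h1' : 1 - (1 - rK K j) / 2 ^ m ≤ 1 := by
    have := rK_lt_one hK j
    rw [sub_le_self_iff]
    exact div_nonneg (by linarith) (by positivity)
  have h2 := hω.wh_anti (rK_nonneg hK _) hle h1'
  have h3 := hKω _ (rK_nonneg hK (j + 2)) (rK_lt_one hK _)
  rw [one_sub_one_sub_rK_div] at h3
  refine h1.trans ?_
  rw [mul_assoc]
  refine mul_le_mul_of_nonneg_left (h2.trans ?_) (by positivity)
  rw [le_inv_mul_iff₀ hC']
  have h4 : wh ω (rK K (j + 3)) ≤ 1 / C0 * wh ω (rK K (j + 2)) := by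
    rw [one_div, le_inv_mul_iff₀ (by linarith)]
    exact h3
  linarith

end Weight

/-- The mean on a circle meeting the `j`-th row is bounded by the row of suprema. -/
lemma ofReal_circleAverage_le {p : ℝ} (hp : 0 < p) {K : ℕ} (hK : 2 ≤ K) {f : ℂ → ℂ}
    (hf : DifferentiableOn ℂ f (Metric.ball 0 1)) {j : ℕ} {r : ℝ} (hr : rK K j ≤ r)
    (hr' : r < rK K (j + 1)) :
    ENNReal.ofReal (Real.circleAverage (fun w => ‖f w‖ ^ p) 0 r) ≤
      ENNReal.ofReal ((K:ℝ) ^ j)⁻¹ * ∑ l ∈ Finset.range (K ^ (j + 3)),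
        (⨆ w ∈ Qset K j l, ENNReal.ofReal ‖f w‖) ^ p := by
  have hT := Real.two_pi_pos
  have hr0 : 0 ≤ r := (rK_nonneg hK j).trans hr
  have hr1 : r < 1 := hr'.trans (rK_lt_one hK _)
  have hKr : (1:ℝ) ≤ K := by exact_mod_cast (by omega : 1 ≤ K)
  set N := K ^ (j + 3) with hN
  have hNr : (0:ℝ) < N := by rw [hN]; positivity
  set φ : ℝ → ℝ := fun y => ‖f (circleMap 0 r y)‖ ^ p with hφ
  have hcont : Continuous φ := by
    refine (hf.continuousOn.norm.rpow_const fun _ _ => Or.inr hp.le).comp_continuous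
      (s := Metric.ball 0 1) (f := circleMap 0 r) (by fun_prop) fun y => ?_
    rw [mem_ball_zero_iff]
    simpa [abs_of_nonneg hr0] using hr1
  set a : ℕ → ℝ := fun l => 2 * Real.pi * l / N with ha
  have hale : ∀ l, a l ≤ a (l + 1) := fun l => by
    simp only [ha]; gcongr; exact Nat.le_succ l
  have hsum : ∫ y in (0:ℝ)..(2 * Real.pi), φ y
      = ∑ l ∈ Finset.range N, ∫ y in (a l)..(a (l + 1)), φ y := by
    rw [intervalIntegral.sum_integral_adjacent_intervals
      fun l _ => hcont.intervalIntegrable _ _]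
    congr 1
    · simp [ha]
    · simp only [ha]; field_simp
  have hpart : ∀ l ∈ Finset.range N, ENNReal.ofReal (∫ y in (a l)..(a (l + 1)), φ y)
      ≤ (⨆ w ∈ Qset K j l, ENNReal.ofReal ‖f w‖) ^ p * ENNReal.ofReal (2 * Real.pi / N) := by
    intro l _
    have e : a (l + 1) - a l = 2 * Real.pi / N := by
      simp only [ha]; push_cast; ring
    rw [← lintegral_Ioc_ofReal (hale l) (hcont.intervalIntegrable _ _)
      fun y _ => by positivity, restrict_Ioc_eq_restrict_Icc, ← restrict_Ico_eq_restrict_Icc,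
      ← e, ← Real.volume_Ico, ← setLIntegral_const]
    refine setLIntegral_mono' measurableSet_Ico fun y hy => ?_
    rw [← ENNReal.ofReal_rpow_of_nonneg (norm_nonneg _) hp.le]
    refine ENNReal.rpow_le_rpow (le_iSup₂_of_le (circleMap 0 r y) ?_ le_rfl) hp.le
    have hnorm : ‖circleMap 0 r y‖ = r := by simp [abs_of_nonneg hr0]
    refine ⟨by rwa [hnorm], by rwa [hnorm], y, ?_, ?_, ?_⟩
    · have := hy.1
      simp only [ha, hN] at this
      push_cast at this
      exact this
    · have := hy.2
      simp only [ha, hN] at this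
      push_cast at this
      exact this
    · rw [hnorm]; simp [circleMap]
  rw [Real.circleAverage_def, smul_eq_mul, ENNReal.ofReal_mul (by positivity), hsum,
    ENNReal.ofReal_sum_of_nonneg fun l _ =>
      intervalIntegral.integral_nonneg (hale l) fun y _ => by positivity]
  refine (mul_le_mul_right (Finset.sum_le_sum hpart) _).trans ?_
  rw [← Finset.sum_mul, mul_comm (Finset.sum _ _), ← mul_assoc]
  refine mul_le_mul_left ?_ _
  rw [← ENNReal.ofReal_mul (by positivity)]
  apply ENNReal.ofReal_le_ofReal
  have e : (2 * Real.pi)⁻¹ * (2 * Real.pi / N) = (N:ℝ)⁻¹ := by field_simp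
  rw [e, hN, Nat.cast_pow]
  gcongr
  omega

lemma row_lamSeq_eq {p q : ℝ} (hp : 0 < p) (hq : 0 < q) {ω : ℝ → ℝ} (hω : RadialWeight ω)
    {K : ℕ} (hK : 2 ≤ K) (f : ℂ → ℂ) (j : ℕ) :
    ((∑' l, lamSeq K p q ω f j l ^ p) ^ p⁻¹) ^ q = ENNReal.ofReal (wh ω (rK K j)) *
      (ENNReal.ofReal ((K:ℝ) ^ j)⁻¹ * ∑ l ∈ Finset.range (K ^ (j + 3)),
        (⨆ w ∈ Qset K j l, ENNReal.ofReal ‖f w‖) ^ p) ^ (q / p) := by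
  have hKr : (0:ℝ) < K := by exact_mod_cast (by omega : 0 < K)
  have hw := hω.wh_nonneg (rK_lt_one hK j).le
  have hterm : ∀ l ∈ Finset.range (K ^ (j + 3)), lamSeq K p q ω f j l ^ p
      = ENNReal.ofReal (wh ω (rK K j)) ^ (p / q) * ENNReal.ofReal ((K:ℝ) ^ j)⁻¹ *
        (⨆ w ∈ Qset K j l, ENNReal.ofReal ‖f w‖) ^ p := by
    intro l hl
    rw [lamSeq, if_pos (Finset.mem_range.1 hl), ENNReal.mul_rpow_of_nonneg _ _ hp.le]
    congr 1
    rw [ENNReal.ofReal_rpow_of_nonneg (by positivity) hp.le,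
      ENNReal.ofReal_rpow_of_nonneg hw (by positivity), ← ENNReal.ofReal_mul (by positivity),
      Real.mul_rpow (by positivity) (by positivity), ← Real.rpow_mul hKr.le, ← Real.rpow_mul hw,
      mul_comm, div_mul_cancel₀ _ hp.ne', Real.rpow_neg hKr.le, Real.rpow_natCast, one_div_mul_eq_div]
  rw [tsum_eq_sum (s := Finset.range (K ^ (j + 3))) fun l hl => by
      rw [lamSeq, if_neg (fun h => hl (Finset.mem_range.2 h)), ENNReal.zero_rpow_of_pos hp],
    Finset.sum_congr rfl hterm, ← Finset.mul_sum, ← ENNReal.rpow_mul, mul_assoc,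
    ENNReal.mul_rpow_of_nonneg _ _ (by positivity), ← ENNReal.rpow_mul,
    show p / q * (p⁻¹ * q) = 1 by field_simp, ENNReal.rpow_one, inv_mul_eq_div]

lemma ofReal_MpR_rpow {p : ℝ} (hp : 0 < p) (q : ℝ) (f : ℂ → ℂ) (r : ℝ) :
    ENNReal.ofReal (MpR p f r) ^ q
      = ENNReal.ofReal (Real.circleAverage (fun w => ‖f w‖ ^ p) 0 r) ^ (q / p) := by
  rw [MpR_eq, ← ENNReal.ofReal_rpow_of_nonneg (circleAverage_norm_rpow_nonneg p f r)
    (by positivity), ← ENNReal.rpow_mul, inv_mul_eq_div]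

lemma lintegral_MpR_le {p q : ℝ} (hp : 0 < p) (hq : 0 < q) {ω : ℝ → ℝ} (hω : RadialWeight ω)
    {K : ℕ} (hK : 2 ≤ K) {f : ℂ → ℂ} (hf : DifferentiableOn ℂ f (Metric.ball 0 1)) :
    ∫⁻ r in Set.Ioo (0:ℝ) 1, ENNReal.ofReal (MpR p f r) ^ q * ENNReal.ofReal (ω r)
      ≤ ∑' j, ((∑' l, lamSeq K p q ω f j l ^ p) ^ p⁻¹) ^ q := by
  have hcov : Set.Ioo (0:ℝ) 1 ⊆ ⋃ j, Set.Ico (rK K j) (rK K (j + 1)) := by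
    intro r hr
    obtain ⟨j, h1, h2⟩ := exists_rK_le_lt hK hr.1.le hr.2
    exact Set.mem_iUnion.2 ⟨j, h1, h2⟩
  refine (lintegral_mono_set hcov).trans ((lintegral_iUnion_le _ _).trans
    (ENNReal.tsum_le_tsum fun j => ?_))
  rw [row_lamSeq_eq hp hq hω hK]
  set X := ENNReal.ofReal ((K:ℝ) ^ j)⁻¹ * ∑ l ∈ Finset.range (K ^ (j + 3)),
        (⨆ w ∈ Qset K j l, ENNReal.ofReal ‖f w‖) ^ p
  have h1 : ∀ r ∈ Set.Ico (rK K j) (rK K (j + 1)),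
      ENNReal.ofReal (MpR p f r) ^ q * ENNReal.ofReal (ω r)
        ≤ ENNReal.ofReal (ω r) * X ^ (q / p) := by
    intro r hr
    rw [mul_comm, ofReal_MpR_rpow hp q]
    gcongr
    exact ofReal_circleAverage_le hp hK hf hr.1 hr.2
  refine (setLIntegral_mono' measurableSet_Ico h1).trans ?_
  have hmono := rK_monotone hK (Nat.le_succ j)
  have hmeas : AEMeasurable (fun r => ENNReal.ofReal (ω r))
      (volume.restrict (Set.Ico (rK K j) (rK K (j + 1)))) := by
    rw [restrict_Ico_eq_restrict_Ioc]
    exact (hω.intervalIntegrable (rK_nonneg hK j) hmono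
      (rK_lt_one hK _).le).1.aestronglyMeasurable.aemeasurable.ennreal_ofReal
  rw [lintegral_mul_const'' _ hmeas, restrict_Ico_eq_restrict_Ioc,
    hω.lintegral_Ioc (rK_nonneg hK j) hmono (rK_lt_one hK _).le]
  gcongr
  exact sub_le_self _ (hω.wh_nonneg (rK_lt_one hK _).le)

lemma exists_tsum_row_le {p q : ℝ} (hp : 0 < p) (hq : 0 < q) {ω : ℝ → ℝ} (hω : RadialWeight ω)
    (hD : Dhat ω) {K : ℕ} (hK : 2 ≤ K) {C0 : ℝ} (hC0 : 1 < C0)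
    (hKω : ∀ r : ℝ, 0 ≤ r → r < 1 → C0 * wh ω (1 - (1 - r) / K) ≤ wh ω r) :
    ∃ C : ℝ, 0 ≤ C ∧ ∀ f : ℂ → ℂ, DifferentiableOn ℂ f (Metric.ball 0 1) →
      ∑' j, ((∑' l, lamSeq K p q ω f j l ^ p) ^ p⁻¹) ^ q ≤ ENNReal.ofReal C *
        ∫⁻ r in Set.Ioo (0:ℝ) 1, ENNReal.ofReal (MpR p f r) ^ q * ENNReal.ofReal (ω r) := by
  obtain ⟨C, hC, h⟩ := exists_wh_rK_le hω hD hK hC0 hKω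
  have hKr : (0:ℝ) < K := by exact_mod_cast (by omega : 0 < K)
  have hB : (0:ℝ) ≤ (24 * (K:ℝ) ^ 6) ^ (q / p) := by positivity
  refine ⟨(24 * (K:ℝ) ^ 6) ^ (q / p) * C, by positivity, fun f hf => ?_⟩
  set F : ℝ → ℝ≥0∞ := fun r => ENNReal.ofReal (MpR p f r) ^ q * ENNReal.ofReal (ω r) with hF
  have hrow : ∀ j, ((∑' l, lamSeq K p q ω f j l ^ p) ^ p⁻¹) ^ q
      ≤ ENNReal.ofReal ((24 * (K:ℝ) ^ 6) ^ (q / p) * C) *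
        ∫⁻ r in Set.Ioc (rK K (j + 2)) (rK K (j + 3)), F r := by
    intro j
    have hmono : rK K (j + 2) ≤ rK K (j + 3) := rK_monotone hK (Nat.le_succ _)
    have h1 : ENNReal.ofReal ((K:ℝ) ^ j)⁻¹ * ∑ l ∈ Finset.range (K ^ (j + 3)),
        (⨆ w ∈ Qset K j l, ENNReal.ofReal ‖f w‖) ^ p ≤ ENNReal.ofReal (24 * (K:ℝ) ^ 6) *
          ENNReal.ofReal (Real.circleAverage (fun w => ‖f w‖ ^ p) 0 (rK K (j + 2))) := by
      refine (mul_le_mul_right (sum_iSup_Qset_le hp hK hf j) _).trans (le_of_eq ?_)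
      rw [← ENNReal.ofReal_mul (by positivity), ← ENNReal.ofReal_mul (by positivity)]
      congr 1
      field_simp
    have h2 : ENNReal.ofReal (MpR p f (rK K (j + 2))) ^ q *
        ENNReal.ofReal (wh ω (rK K (j + 2)) - wh ω (rK K (j + 3)))
          ≤ ∫⁻ r in Set.Ioc (rK K (j + 2)) (rK K (j + 3)), F r := by
      rw [← hω.lintegral_Ioc (rK_nonneg hK _) hmono (rK_lt_one hK _).le]
      refine (lintegral_const_mul_le _ _).trans
        (setLIntegral_mono' measurableSet_Ioc fun r hr => ?_)
      simp only [hF]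
      gcongr
      exact MpR_mono hp hf (rK_nonneg hK _) hr.1.le (hr.2.trans_lt (rK_lt_one hK _))
    rw [row_lamSeq_eq hp hq hω hK]
    calc ENNReal.ofReal (wh ω (rK K j)) *
          (ENNReal.ofReal ((K:ℝ) ^ j)⁻¹ * ∑ l ∈ Finset.range (K ^ (j + 3)),
            (⨆ w ∈ Qset K j l, ENNReal.ofReal ‖f w‖) ^ p) ^ (q / p)
        ≤ ENNReal.ofReal (C * (wh ω (rK K (j + 2)) - wh ω (rK K (j + 3)))) *
          (ENNReal.ofReal (24 * (K:ℝ) ^ 6) * ENNReal.ofReal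
            (Real.circleAverage (fun w => ‖f w‖ ^ p) 0 (rK K (j + 2)))) ^ (q / p) := by
          gcongr
          exact h j
      _ = ENNReal.ofReal ((24 * (K:ℝ) ^ 6) ^ (q / p) * C) *
          (ENNReal.ofReal (MpR p f (rK K (j + 2))) ^ q *
            ENNReal.ofReal (wh ω (rK K (j + 2)) - wh ω (rK K (j + 3)))) := by
          rw [ENNReal.mul_rpow_of_nonneg _ _ (by positivity), ← ofReal_MpR_rpow hp q,
            ENNReal.ofReal_rpow_of_nonneg (by positivity) (by positivity),
            ENNReal.ofReal_mul hC, ENNReal.ofReal_mul hB]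
          ring
      _ ≤ _ := by gcongr
  refine (ENNReal.tsum_le_tsum hrow).trans ?_
  rw [ENNReal.tsum_mul_left]
  gcongr
  have hdisj : Pairwise (Function.onFun Disjoint
      fun j : ℕ => Set.Ioc (rK K (j + 2)) (rK K (j + 3))) :=
    Monotone.pairwise_disjoint_on_Ioc_succ (f := fun j => rK K (j + 2))
      fun i j hij => rK_monotone hK (by omega)
  rw [← lintegral_iUnion (fun j => measurableSet_Ioc) hdisj]
  refine lintegral_mono_set (Set.iUnion_subset fun j r hr => ⟨?_, ?_⟩)
  · exact (rK_nonneg hK _).trans_lt hr.1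
  · exact hr.2.trans_lt (rK_lt_one hK _)

/-- `‖f‖_{A^{p,q}_ω} ≍ ‖λ(f)‖_{ℓ^{p,q}}` for analytic `f`. -/
theorem stmt8 (p q : ℝ) (hp : 0 < p) (hq : 0 < q)
    (ω : ℝ → ℝ) (hω : RadialWeight ω) (hωD : DClass ω)
    (K : ℕ) (hK : 2 ≤ K) (C0 : ℝ) (hC0 : 1 < C0)
    (hKω : ∀ r : ℝ, 0 ≤ r → r < 1 → C0 * wh ω (1 - (1 - r) / K) ≤ wh ω r) :
    ∃ C : ℝ, 0 < C ∧ ∀ f : ℂ → ℂ, DifferentiableOn ℂ f (Metric.ball (0:ℂ) 1) →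
      ApqE p q ω f ≤ ENNReal.ofReal C * lpqR p q (lamSeq K p q ω f) ∧
      lpqR p q (lamSeq K p q ω f) ≤ ENNReal.ofReal C * ApqE p q ω f := by
  obtain ⟨C, hC, h⟩ := exists_tsum_row_le hp hq hω hωD.1 hK hC0 hKω
  have hC' : 0 ≤ C ^ q⁻¹ := by positivity
  refine ⟨1 + C ^ q⁻¹, by positivity, fun f hf => ⟨?_, ?_⟩⟩
  · have h1 : ApqE p q ω f ≤ lpqR p q (lamSeq K p q ω f) :=
      ENNReal.rpow_le_rpow (lintegral_MpR_le hp hq hω hK hf) (by positivity)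
    refine h1.trans (le_mul_of_one_le_left' ?_)
    rw [← ENNReal.ofReal_one]
    exact ENNReal.ofReal_le_ofReal (by linarith)
  · have h1 : lpqR p q (lamSeq K p q ω f) ≤ ENNReal.ofReal (C ^ q⁻¹) * ApqE p q ω f := by
      rw [← ENNReal.ofReal_rpow_of_nonneg hC (by positivity), ApqE,
        ← ENNReal.mul_rpow_of_nonneg _ _ (by positivity)]
      exact ENNReal.rpow_le_rpow (h f hf) (by positivity)
    refine h1.trans ?_
    gcongr
    linarith

end
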